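/- arXiv:2309.15058 — 8 statements merged into one kernel-verified Lean document; each statement's English description precedes it below -/
import Mathlib

section
/- In the category 𝒥 of finite-dimensional real inner product spaces and linear isometric embeddings, no pair of objects both of positive dimension admits a categorical coproduct; in particular, for every object V with dim V > 0 the pair (V, V) has no coproduct in 𝒥. -/
open CategoryTheory

/-- An object of the category `𝒥`: a finite-dimensional real inner product space. -/
structure JObj : Type 1 where
  carrier : Type
  [nacg : NormedAddCommGroup carrier]
  [ips : InnerProductSpace ℝ carrier]
  [fd : FiniteDimensional ℝ carrier]

attribute [instance] JObj.nacg JObj.ips JObj.fd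

instance : CoeSort JObj Type := ⟨JObj.carrier⟩

/-- The category `𝒥` of finite-dimensional real inner product spaces and linear
isometric embeddings (linear isometries are automatically injective). -/
instance : Category JObj where
  Hom V W := V →ₗᵢ[ℝ] W
  id V := LinearIsometry.id
  comp f g := g.comp f

/-- The orthogonal sum. -/
noncomputable def JSum (V W : JObj) : JObj where
  carrier := WithLp 2 (V × W)

noncomputable def JInl (V W : JObj) : V →ₗᵢ[ℝ] JSum V W where
  toLinearMap := (WithLp.linearEquiv 2 ℝ (V × W)).symm.toLinearMap ∘ₗ LinearMap.inl ℝ V W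
  norm_map' x := WithLp.norm_toLp_fst 2 V W x

noncomputable def JInr (V W : JObj) : W →ₗᵢ[ℝ] JSum V W where
  toLinearMap := (WithLp.linearEquiv 2 ℝ (V × W)).symm.toLinearMap ∘ₗ LinearMap.inr ℝ V W
  norm_map' x := WithLp.norm_toLp_snd 2 V W x

theorem JInl_inner_JInr (V W : JObj) (v : V) (w : W) :
    inner ℝ (JInl V W v) (JInr V W w) = 0 := by
  change inner ℝ (WithLp.toLp 2 (v, (0 : W))) (WithLp.toLp 2 ((0 : V), w)) = 0
  simp

theorem inner_of_coprod {V W U : JObj} [Limits.HasBinaryCoproduct V W]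
    (f : V →ₗᵢ[ℝ] U) (g : W →ₗᵢ[ℝ] U) (v : V) (w : W) :
    inner ℝ (f v) (g w) = inner ℝ
      ((show V →ₗᵢ[ℝ] (Limits.coprod V W : JObj) from (Limits.coprod.inl : V ⟶ Limits.coprod V W)) v)
      ((show W →ₗᵢ[ℝ] (Limits.coprod V W : JObj) from (Limits.coprod.inr : W ⟶ Limits.coprod V W)) w) := by
  let f' : V ⟶ U := f
  let g' : W ⟶ U := g
  let d : (Limits.coprod V W : JObj) →ₗᵢ[ℝ] U := Limits.coprod.desc f' g'
  have h1 : d.comp (show V →ₗᵢ[ℝ] (Limits.coprod V W : JObj) from (Limits.coprod.inl : V ⟶ Limits.coprod V W)) = f :=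
    Limits.coprod.inl_desc f' g'
  have h2 : d.comp (show W →ₗᵢ[ℝ] (Limits.coprod V W : JObj) from (Limits.coprod.inr : W ⟶ Limits.coprod V W)) = g :=
    Limits.coprod.inr_desc f' g'
  rw [← h1, ← h2]
  exact d.inner_map_map _ _

theorem no_coprod_aux (V W : JObj) (hV : 0 < Module.finrank ℝ V) (hW : 0 < Module.finrank ℝ W) :
    ¬ Limits.HasBinaryCoproduct V W := by
  intro h
  have : Nontrivial V := Module.nontrivial_of_finrank_pos hV
  have : Nontrivial W := Module.nontrivial_of_finrank_pos hW
  obtain ⟨v, hv⟩ := exists_norm_eq V zero_le_one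
  obtain ⟨w, hw⟩ := exists_norm_eq W zero_le_one
  have e : ‖JInr V W w‖ = ‖JInl V W v‖ := by simp [hv, hw]
  have h1 := inner_of_coprod (JInl V W) (JInr V W) v w
  have h2 := inner_of_coprod (JInl V W)
    ((Submodule.reflection (ℝ ∙ (JInr V W w - JInl V W v))ᗮ).toLinearIsometry.comp (JInr V W)) v w
  rw [← h1, JInl_inner_JInr] at h2
  have h3 : inner ℝ (JInl V W v)
      (Submodule.reflection (ℝ ∙ (JInr V W w - JInl V W v))ᗮ (JInr V W w)) = 0 := h2
  rw [Submodule.reflection_sub e, real_inner_self_eq_norm_sq] at h3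
  simp [hv] at h3

/-- In the category `𝒥` of finite-dimensional real inner product spaces and linear isometric
embeddings, no pair of objects of positive dimension admits a categorical coproduct; in
particular for every object `V` of positive dimension the pair `(V, V)` has no coproduct. -/
theorem no_coproducts_in_J :
    (∀ V W : JObj, 0 < Module.finrank ℝ V → 0 < Module.finrank ℝ W →
      ¬ Limits.HasBinaryCoproduct V W) ∧
    (∀ V : JObj, 0 < Module.finrank ℝ V → ¬ Limits.HasBinaryCoproduct V V) := by
  exact ⟨no_coprod_aux, fun V h => no_coprod_aux V V h h⟩
end

section
/- Extension of isometric automorphisms is functorial: for linear isometric embeddings f : V → W and g : W → X of finite-dimensional real inner product spaces and every φ ∈ O(V), one has ext_g(ext_f(φ)) = ext_{g∘f}(φ), and ext_{id_V}(φ) = φ; hence V ↦ O(V), f ↦ ext_f defines a functor from 𝒥 to groups. -/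
open CategoryTheory
open scoped RealInnerProductSpace

namespace JObj

/-- A morphism of `𝒥`, viewed as a linear isometry. -/
def toLI {V W : JObj} (f : V ⟶ W) : V.carrier →ₗᵢ[ℝ] W.carrier := f

/-- `ψ` is the extension of the isometric automorphism `φ` along the linear isometric
embedding `f`, i.e. `ψ` equals `f ∘ φ ∘ f⁻¹` on the range of `f` and the identity on its
orthogonal complement. -/
def IsExtension {V W : JObj} (f : V ⟶ W) (φ : V.carrier ≃ₗᵢ[ℝ] V.carrier)
    (ψ : W.carrier ≃ₗᵢ[ℝ] W.carrier) : Prop :=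
  (∀ v : V.carrier, ψ (toLI f v) = toLI f (φ v)) ∧
  ∀ w ∈ (LinearMap.range (toLI f).toLinearMap)ᗮ, ψ w = w

end JObj

namespace JObj

theorem adj_apply {V W : JObj} (f : V.carrier →ₗᵢ[ℝ] W.carrier) (v : V.carrier) :
    LinearMap.adjoint f.toLinearMap (f v) = v := by
  refine ext_inner_right ℝ fun x => ?_
  rw [LinearMap.adjoint_inner_left]
  exact f.inner_map_map v x

theorem sub_mem {V W : JObj} (f : V.carrier →ₗᵢ[ℝ] W.carrier) (w : W.carrier) :
    w - f (LinearMap.adjoint f.toLinearMap w) ∈ (LinearMap.range f.toLinearMap)ᗮ := by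
  rw [Submodule.mem_orthogonal']
  rintro _ ⟨v, rfl⟩
  rw [← LinearMap.adjoint_inner_left, map_sub, adj_apply, sub_self, inner_zero_left]

theorem adj_zero {V W : JObj} (f : V.carrier →ₗᵢ[ℝ] W.carrier) (w : W.carrier)
    (hw : w ∈ (LinearMap.range f.toLinearMap)ᗮ) :
    LinearMap.adjoint f.toLinearMap w = 0 := by
  refine ext_inner_right ℝ fun x => ?_
  rw [LinearMap.adjoint_inner_left, inner_zero_left]
  exact (Submodule.mem_orthogonal' _ _).1 hw _ ⟨x, rfl⟩

theorem IsExtension.unique {V W : JObj} {f : V ⟶ W} {φ : V.carrier ≃ₗᵢ[ℝ] V.carrier}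
    {ψ ψ' : W.carrier ≃ₗᵢ[ℝ] W.carrier} (h : IsExtension f φ ψ) (h' : IsExtension f φ ψ') :
    ψ = ψ' := by
  ext w
  have e : w = (w - toLI f (LinearMap.adjoint (toLI f).toLinearMap w)) +
    toLI f (LinearMap.adjoint (toLI f).toLinearMap w) := by abel
  rw [e, map_add, map_add, h.1, h'.1, h.2 _ (sub_mem _ _), h'.2 _ (sub_mem _ _)]

/-- The extension as a linear map. -/
noncomputable def extLin {V W : JObj} (f : V.carrier →ₗᵢ[ℝ] W.carrier)
    (φ : V.carrier ≃ₗᵢ[ℝ] V.carrier) : W.carrier →ₗ[ℝ] W.carrier :=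
  LinearMap.id + f.toLinearMap ∘ₗ (φ.toLinearEquiv.toLinearMap - LinearMap.id) ∘ₗ
    LinearMap.adjoint f.toLinearMap

theorem extLin_apply {V W : JObj} (f : V.carrier →ₗᵢ[ℝ] W.carrier)
    (φ : V.carrier ≃ₗᵢ[ℝ] V.carrier) (w : W.carrier) :
    extLin f φ w = w + f (φ (LinearMap.adjoint f.toLinearMap w) -
      LinearMap.adjoint f.toLinearMap w) := rfl

theorem extLin_norm {V W : JObj} (f : V.carrier →ₗᵢ[ℝ] W.carrier)
    (φ : V.carrier ≃ₗᵢ[ℝ] V.carrier) (w : W.carrier) : ‖extLin f φ w‖ = ‖w‖ := by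
  rw [← sq_eq_sq₀ (norm_nonneg _) (norm_nonneg _), extLin_apply, norm_add_sq_real,
    f.norm_map, norm_sub_sq_real, φ.norm_map]
  have := LinearMap.adjoint_inner_left f.toLinearMap
    (φ (LinearMap.adjoint f.toLinearMap w) - LinearMap.adjoint f.toLinearMap w) w
  rw [inner_sub_right, real_inner_self_eq_norm_sq, real_inner_comm] at this
  change _ = inner ℝ w (f _) at this
  rw [← this]
  ring

/-- The extension as an isometric automorphism. -/
noncomputable def extIso {V W : JObj} (f : V.carrier →ₗᵢ[ℝ] W.carrier)
    (φ : V.carrier ≃ₗᵢ[ℝ] V.carrier) : W.carrier ≃ₗᵢ[ℝ] W.carrier :=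
  LinearIsometry.toLinearIsometryEquiv ⟨extLin f φ, extLin_norm f φ⟩ rfl

theorem extIso_apply {V W : JObj} (f : V.carrier →ₗᵢ[ℝ] W.carrier)
    (φ : V.carrier ≃ₗᵢ[ℝ] V.carrier) (w : W.carrier) :
    extIso f φ w = w + f (φ (LinearMap.adjoint f.toLinearMap w) -
      LinearMap.adjoint f.toLinearMap w) := rfl

theorem extIso_isExtension {V W : JObj} (f : V ⟶ W) (φ : V.carrier ≃ₗᵢ[ℝ] V.carrier) :
    IsExtension f φ (extIso (toLI f) φ) := by
  refine ⟨fun v => ?_, fun w hw => ?_⟩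
  · rw [extIso_apply, adj_apply, map_sub]; abel
  · rw [extIso_apply, adj_zero _ _ hw]; simp

theorem IsExtension.comp {V W X : JObj} {f : V ⟶ W} {g : W ⟶ X}
    {φ : V.carrier ≃ₗᵢ[ℝ] V.carrier}
    {ψ₁ : W.carrier ≃ₗᵢ[ℝ] W.carrier} {ψ₂ : X.carrier ≃ₗᵢ[ℝ] X.carrier}
    (h₁ : IsExtension f φ ψ₁) (h₂ : IsExtension g ψ₁ ψ₂) : IsExtension (f ≫ g) φ ψ₂ := by
  have hc : ∀ v, toLI (f ≫ g) v = toLI g (toLI f v) := fun _ => rfl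
  refine ⟨fun v => ?_, fun x hx => ?_⟩
  · rw [hc, hc, h₂.1, h₁.1]
  · have hm : LinearMap.adjoint (toLI g).toLinearMap x ∈
        (LinearMap.range (toLI f).toLinearMap)ᗮ := by
      rw [Submodule.mem_orthogonal']
      rintro _ ⟨v, rfl⟩
      rw [LinearMap.adjoint_inner_left]
      exact (Submodule.mem_orthogonal' _ _).1 hx _ ⟨v, rfl⟩
    have e : x = (x - toLI g (LinearMap.adjoint (toLI g).toLinearMap x)) +
      toLI g (LinearMap.adjoint (toLI g).toLinearMap x) := by abel
    have : ψ₂ ((x - toLI g (LinearMap.adjoint (toLI g).toLinearMap x)) +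
      toLI g (LinearMap.adjoint (toLI g).toLinearMap x)) =
      (x - toLI g (LinearMap.adjoint (toLI g).toLinearMap x)) +
      toLI g (LinearMap.adjoint (toLI g).toLinearMap x) := by
      rw [map_add, h₂.1, h₂.2 _ (sub_mem _ _), h₁.2 _ hm]
    rwa [← e] at this

theorem IsExtension.mul {V W : JObj} {f : V ⟶ W} {φ φ' : V.carrier ≃ₗᵢ[ℝ] V.carrier}
    {ψ ψ' : W.carrier ≃ₗᵢ[ℝ] W.carrier} (h : IsExtension f φ ψ) (h' : IsExtension f φ' ψ') :
    IsExtension f (φ * φ') (ψ * ψ') := by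
  refine ⟨fun v => ?_, fun w hw => ?_⟩
  · change ψ (ψ' _) = toLI f (φ (φ' v))
    rw [h'.1, h.1]
  · change ψ (ψ' _) = _
    rw [h'.2 _ hw, h.2 _ hw]

theorem isExtension_id {V : JObj} (φ : V.carrier ≃ₗᵢ[ℝ] V.carrier) :
    IsExtension (𝟙 V) φ φ := by
  refine ⟨fun v => rfl, fun w hw => ?_⟩
  have : w = 0 := by
    have := (Submodule.mem_orthogonal' _ _).1 hw w ⟨w, rfl⟩
    exact inner_self_eq_zero.1 this
  rw [this, map_zero]

/-- Extension as a group homomorphism. -/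
noncomputable def extHom {V W : JObj} (f : V ⟶ W) :
    (V.carrier ≃ₗᵢ[ℝ] V.carrier) →* (W.carrier ≃ₗᵢ[ℝ] W.carrier) :=
  MonoidHom.mk' (extIso (toLI f)) fun a b =>
    (extIso_isExtension f (a * b)).unique
      ((extIso_isExtension f a).mul (extIso_isExtension f b))

/-- The functor `V ↦ O(V)`. -/
noncomputable def orthFunctor : JObj ⥤ GrpCat.{0} where
  obj V := GrpCat.of (V.carrier ≃ₗᵢ[ℝ] V.carrier)
  map f := GrpCat.ofHom (extHom f)
  map_id V := by
    ext φ : 2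
    exact (extIso_isExtension (𝟙 V) φ).unique (isExtension_id φ)
  map_comp f g := by
    ext φ : 2
    exact (extIso_isExtension (f ≫ g) φ).unique
      ((extIso_isExtension f φ).comp (extIso_isExtension g _))

end JObj

open JObj in
/-- Extension of isometric automorphisms is functorial: extensions compose, extension
along the identity is the identity, and consequently `V ↦ O(V)`, `f ↦ ext_f` defines a
functor from `𝒥` to the category of groups. -/
theorem extension_functorial :
    (∀ {V W X : JObj} (f : V ⟶ W) (g : W ⟶ X) (φ : V.carrier ≃ₗᵢ[ℝ] V.carrier)
      (ψ₁ : W.carrier ≃ₗᵢ[ℝ] W.carrier) (ψ₂ : X.carrier ≃ₗᵢ[ℝ] X.carrier),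
      IsExtension f φ ψ₁ → IsExtension g ψ₁ ψ₂ → IsExtension (f ≫ g) φ ψ₂) ∧
    (∀ {V : JObj} (φ ψ : V.carrier ≃ₗᵢ[ℝ] V.carrier),
      IsExtension (𝟙 V) φ ψ → ψ = φ) ∧
    (∃ (O : JObj ⥤ GrpCat.{0}) (e : ∀ V : JObj, (O.obj V : Type) ≃* (V.carrier ≃ₗᵢ[ℝ] V.carrier)),
      ∀ {V W : JObj} (f : V ⟶ W) (φ : V.carrier ≃ₗᵢ[ℝ] V.carrier),
        IsExtension f φ ((e W) (O.map f ((e V).symm φ)))) := by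
  refine ⟨fun f g φ ψ₁ ψ₂ h₁ h₂ => h₁.comp h₂, fun φ ψ h => h.unique (isExtension_id φ),
    orthFunctor, fun V => MulEquiv.refl _, fun f φ => ?_⟩
  exact extIso_isExtension f φ
end

section
/- For a small monoidal category C, Day convolution makes Fun(C, Type) a closed monoidal category: for every functor F : C ⥤ Type the functor F ⊛ − : Fun(C, Type) ⥤ Fun(C, Type) admits a right adjoint 𝓕(F, −), and these right adjoints assemble into a functor 𝓕 : Fun(C, Type)^op × Fun(C, Type) ⥤ Fun(C, Type). -/
open CategoryTheory MonoidalCategory Limits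

universe u

variable {C : Type u} [SmallCategory C] [MonoidalCategory C]

/-- The Day convolution of two `Type`-valued functors: the left Kan extension of the
external product `(X, Y) ↦ F(X) × G(Y)` along the tensor product functor of `C`. -/
noncomputable def day (F G : C ⥤ Type u) : C ⥤ Type u :=
  (tensor C).leftKanExtension (F.prod G ⋙ tensor (Type u))

/-- The external product with `F` on the left, as a functor. -/
def extProdLeft (F : C ⥤ Type u) : (C ⥤ Type u) ⥤ (C × C ⥤ Type u) where
  obj G := F.prod G ⋙ tensor (Type u)
  map {G G'} η := Functor.whiskerRight (NatTrans.prod (𝟙 F) η) (tensor (Type u))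

/-- The external product with `F` on the right, as a functor. -/
def extProdRight (F : C ⥤ Type u) : (C ⥤ Type u) ⥤ (C × C ⥤ Type u) where
  obj G := G.prod F ⋙ tensor (Type u)
  map {G G'} η := Functor.whiskerRight (NatTrans.prod η (𝟙 F)) (tensor (Type u))

/-- The Day convolution endofunctor `F ⊛ -`. -/
noncomputable def dayLeft (F : C ⥤ Type u) : (C ⥤ Type u) ⥤ (C ⥤ Type u) :=
  extProdLeft F ⋙ Functor.lan (tensor C)

/-- The Day convolution endofunctor `- ⊛ F`. -/
noncomputable def dayRight (F : C ⥤ Type u) : (C ⥤ Type u) ⥤ (C ⥤ Type u) :=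
  extProdRight F ⋙ Functor.lan (tensor C)

theorem dayLeft_obj (F G : C ⥤ Type u) : (dayLeft F).obj G = day F G := rfl

/-- The functor `K ↦ (Y ↦ (F ⟶ K(-, Y)))`, contravariant in `F`. -/
def extHom : (C ⥤ Type u)ᵒᵖ ⥤ (C × C ⥤ Type u) ⥤ (C ⥤ Type u) where
  obj F := (Functor.whiskeringLeft _ _ _).obj (CategoryTheory.Prod.swap C C) ⋙ Functor.curry ⋙
    (Functor.whiskeringRight _ _ _).obj (coyoneda.obj F)
  map f := Functor.whiskerLeft _ (Functor.whiskerLeft _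
    ((Functor.whiskeringRight _ _ _).map (coyoneda.map f)))

/-- The hom-set bijection. -/
def extEquiv (F G : C ⥤ Type u) (K : C × C ⥤ Type u) :
    ((extProdLeft F).obj G ⟶ K) ≃ (G ⟶ (extHom.obj (Opposite.op F)).obj K) where
  toFun α :=
    { app Y := ↾fun g => show F ⟶ (Functor.curry.obj (CategoryTheory.Prod.swap C C ⋙ K)).obj Y from
        { app X := ↾fun x => α.app (X, Y) (x, g)
          naturality X X' f := by
            ext x
            have := ConcreteCategory.congr_hom (α.naturality ((f, 𝟙 Y) : (X, Y) ⟶ (X', Y)))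
              (show ((extProdLeft F).obj G).obj (X, Y) from (x, g))
            have e : G.map (𝟙 Y) g = g := by simp
            exact Eq.trans (congrArg (fun t => α.app (X', Y) (F.map f x, t)) e.symm) this }
      naturality Y Y' f := by
        ext g
        apply NatTrans.ext
        funext X
        ext x
        have := ConcreteCategory.congr_hom (α.naturality ((𝟙 X, f) : (X, Y) ⟶ (X, Y')))
          (show ((extProdLeft F).obj G).obj (X, Y) from (x, g))
        have e : F.map (𝟙 X) x = x := by simp
        exact Eq.trans (congrArg (fun t => α.app (X, Y') (t, G.map f g)) e.symm) this }
  invFun β :=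
    { app P := ↾fun p => NatTrans.app (show F ⟶ (Functor.curry.obj (CategoryTheory.Prod.swap C C ⋙ K)).obj P.2 from β.app P.2 p.2) P.1 p.1
      naturality P P' f := by
        obtain ⟨X, Y⟩ := P
        obtain ⟨X', Y'⟩ := P'
        obtain ⟨f₁, f₂⟩ := f
        ext p
        obtain ⟨x, g⟩ := p
        have h1 := ConcreteCategory.congr_hom (β.naturality f₂) g
        let b : F ⟶ (Functor.curry.obj (CategoryTheory.Prod.swap C C ⋙ K)).obj Y := β.app Y g
        have h2 := ConcreteCategory.congr_hom (b.naturality f₁) x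
        have h3 := ConcreteCategory.congr_hom (NatTrans.congr_app
          (show (show F ⟶ (Functor.curry.obj (CategoryTheory.Prod.swap C C ⋙ K)).obj Y' from
            β.app Y' (G.map f₂ g)) = b ≫ (Functor.curry.obj
              (CategoryTheory.Prod.swap C C ⋙ K)).map f₂ from h1) X') (F.map f₁ x)
        refine h3.trans ?_
        have h4 := congrArg (K.map ((𝟙 X', f₂) : (X', Y) ⟶ (X', Y'))) h2
        refine Eq.trans h4 ?_
        change K.map _ (K.map ((f₁, 𝟙 Y) : (X, Y) ⟶ (X', Y)) (b.app X x)) =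
          K.map ((f₁, f₂) : (X, Y) ⟶ (X', Y')) (b.app X x)
        rw [← ConcreteCategory.comp_apply, ← K.map_comp]
        simp }
  left_inv α := rfl
  right_inv β := rfl

def extAdj (F : C ⥤ Type u) : extProdLeft F ⊣ extHom.obj (Opposite.op F) :=
  Adjunction.mkOfHomEquiv
    { homEquiv := extEquiv F
      homEquiv_naturality_left_symm := fun f g => by rfl
      homEquiv_naturality_right := fun f g => by rfl }

noncomputable def dayHom : (C ⥤ Type u)ᵒᵖ ⥤ (C ⥤ Type u) ⥤ (C ⥤ Type u) :=
  extHom ⋙ (Functor.whiskeringLeft _ _ _).obj ((Functor.whiskeringLeft _ _ _).obj (tensor C))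

noncomputable def dayAdj (F : C ⥤ Type u) : dayLeft F ⊣ dayHom.obj (Opposite.op F) :=
  (extAdj F).comp ((tensor C).lanAdjunction (Type u))

/-- Day convolution makes `Fun(C, Type)` closed monoidal: every `F ⊛ -` admits a right
adjoint, and these right adjoints assemble into an internal hom functor
`Fun(C, Type)ᵒᵖ × Fun(C, Type) ⥤ Fun(C, Type)`. -/
theorem day_closed :
    (∀ F : C ⥤ Type u, ∃ R : (C ⥤ Type u) ⥤ (C ⥤ Type u), Nonempty (dayLeft F ⊣ R)) ∧
    (∃ ihomF : ((C ⥤ Type u)ᵒᵖ × (C ⥤ Type u)) ⥤ (C ⥤ Type u),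
      ∀ F : C ⥤ Type u,
        Nonempty (dayLeft F ⊣ (Functor.curry.obj ihomF).obj (Opposite.op F))) := by
  exact ⟨fun F => ⟨_, ⟨dayAdj F⟩⟩, Functor.uncurry.obj dayHom, fun F =>
    ⟨(dayAdj F).ofNatIsoRight
      ((Functor.currying.unitIso.app dayHom).app (Opposite.op F))⟩⟩
end

section
/- Let C be a small symmetric monoidal category and A, B : C ⥤ Type. The Day convolution internal hom satisfies 𝓕(A, B)(X) ≅ Nat(A, B(− ⊗ X)), naturally in X ∈ C, where B(− ⊗ X) denotes the precomposition of B with the functor V ↦ V ⊗ X and Nat denotes the set of natural transformations. -/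
open CategoryTheory MonoidalCategory Limits

universe u

variable {C : Type u} [SmallCategory C] [MonoidalCategory C]

/-- The functor `X ↦ Nat(A, B(- ⊗ X))`. -/
noncomputable def homFormula (A B : C ⥤ Type u) : C ⥤ Type u where
  obj X := A ⟶ ((tensoringRight C).obj X ⋙ B)
  map {X Y} g := ↾fun η => η ≫ Functor.whiskerRight ((tensoringRight C).map g) B
  map_id X := by
    refine ConcreteCategory.hom_ext _ _ fun η => ?_
    simp
  map_comp f g := by
    refine ConcreteCategory.hom_ext _ _ fun η => ?_
    simp

theorem extNat {A B G : C ⥤ Type u} (φ : (extProdLeft A).obj G ⟶ tensor C ⋙ B)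
    {V W X Y : C} (f : V ⟶ W) (k : X ⟶ Y) (a : A.obj V) (g : G.obj X) :
    φ.app (W, Y) (show A.obj W × G.obj Y from (A.map f a, G.map k g)) =
      B.map (f ⊗ₘ k) (φ.app (V, X) (show A.obj V × G.obj X from (a, g))) := by
  let x : A.obj V × G.obj X := (a, g)
  have := ConcreteCategory.congr_hom
    (φ.naturality (X := (V, X)) (Y := (W, Y)) (Prod.mkHom f k)) x
  exact this

/-- Currying. -/
noncomputable def homCurry (A B G : C ⥤ Type u) :
    ((extProdLeft A).obj G ⟶ tensor C ⋙ B) ≃ (G ⟶ homFormula A B) where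
  toFun φ :=
    { app := fun X => ↾fun g =>
        ({ app := fun V => ↾fun a => φ.app (V, X) (a, g)
           naturality := fun V W f => by
            refine ConcreteCategory.hom_ext _ _ fun a => ?_
            have := extNat φ f (𝟙 X) a g
            rw [MonoidalCategory.tensorHom_id, FunctorToTypes.map_id_apply] at this
            exact this } : A ⟶ ((tensoringRight C).obj X ⋙ B))
      naturality := fun X Y f => by
        refine ConcreteCategory.hom_ext _ _ fun g => ?_
        refine NatTrans.ext (funext fun V => ?_)
        refine ConcreteCategory.hom_ext _ _ fun a => ?_
        have := extNat φ (𝟙 V) f a g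
        rw [MonoidalCategory.id_tensorHom, FunctorToTypes.map_id_apply] at this
        exact this }
  invFun ψ :=
    { app := fun p => ↾fun x => (show A ⟶ ((tensoringRight C).obj p.2 ⋙ B) from ψ.app p.2 x.2).app p.1 x.1
      naturality := by
        rintro ⟨V, X⟩ ⟨W, Y⟩ ⟨f, k⟩
        refine ConcreteCategory.hom_ext _ _ ?_
        rintro ⟨a, g⟩
        have h1 := ConcreteCategory.congr_hom (ψ.naturality k) g
        have h2 := ConcreteCategory.congr_hom (NatTrans.congr_app h1 W) (A.map f a)
        have h3 := ConcreteCategory.congr_hom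
          ((show A ⟶ ((tensoringRight C).obj X ⋙ B) from ψ.app X g).naturality f) a
        refine h2.trans ?_
        refine (congrArg (B.map (W ◁ k)) h3).trans ?_
        refine Eq.trans ?_ (congrArg (fun t => B.map t
          ((show A ⟶ ((tensoringRight C).obj X ⋙ B) from ψ.app X g).app V a))
          (MonoidalCategory.tensorHom_def f k).symm)
        exact (FunctorToTypes.map_comp_apply B _ _ _).symm }
  left_inv φ := rfl
  right_inv ψ := rfl

theorem homCurry_naturality (A B : C ⥤ Type u) {G G' : C ⥤ Type u} (f : G' ⟶ G)
    (φ : (extProdLeft A).obj G ⟶ tensor C ⋙ B) :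
    homCurry A B G' ((extProdLeft A).map f ≫ φ) = f ≫ homCurry A B G φ := rfl

/-- The Day convolution internal hom satisfies
`𝓕(A, B)(X) ≅ Nat(A, B(- ⊗ X))`, naturally in `X`. -/
theorem internalHom_formula [SymmetricCategory C] (A B : C ⥤ Type u)
    (R : (C ⥤ Type u) ⥤ (C ⥤ Type u)) (adj : dayLeft A ⊣ R) :
    Nonempty (R.obj B ≅ homFormula A B) := by
  let e : ∀ G : C ⥤ Type u, (G ⟶ R.obj B) ≃ (G ⟶ homFormula A B) := fun G =>
    ((adj.homEquiv G B).symm.trans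
      (((tensor C).lanAdjunction (Type u)).homEquiv ((extProdLeft A).obj G) B)).trans
      (homCurry A B G)
  have he : ∀ {G G' : C ⥤ Type u} (f : G' ⟶ G) (g : G ⟶ R.obj B),
      e G' (f ≫ g) = f ≫ e G g := by
    intro G G' f g
    have h1 := adj.homEquiv_naturality_left_symm f g
    have h2 := ((tensor C).lanAdjunction (Type u)).homEquiv_naturality_left
      ((extProdLeft A).map f) ((adj.homEquiv G B).symm g)
    refine Eq.trans ?_ (homCurry_naturality A B f _)
    refine congrArg (homCurry A B G') ?_
    exact (congrArg _ h1).trans h2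
  exact ⟨Yoneda.ext _ _ (fun {G} => e G) (fun {G} => (e G).symm) (fun {G} x => (e G).left_inv x)
    (fun {G} x => (e G).right_inv x) (fun f g => he f g)⟩
end

section
/- Let C be a small symmetric monoidal category, A, B : C ⥤ Type, and U an object of C; write sh_U^* for precomposition with the functor V ↦ V ⊗ U. Then there is a natural isomorphism sh_U^* 𝓕(A, B) ≅ 𝓕(A, sh_U^* B) of functors C ⥤ Type. -/
open CategoryTheory MonoidalCategory Limits

universe u

variable {C : Type u} [SmallCategory C] [MonoidalCategory C]

/-- The explicit internal hom `V ↦ Nat(A, B(- ⊗ V))`. -/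
def ihomFun (A B : C ⥤ Type u) : C ⥤ Type u :=
  tensoringRight C ⋙ (Functor.whiskeringRight C C (Type u)).obj B ⋙ coyoneda.obj (Opposite.op A)

/-- Currying for the explicit internal hom. -/
def ihomCurry (A B G : C ⥤ Type u) :
    (G ⟶ ihomFun A B) ≃ ((extProdLeft A).obj G ⟶ tensor C ⋙ B) where
  toFun φ :=
    { app := fun p => TypeCat.ofHom fun (x : A.obj p.1 × G.obj p.2) =>
        (show A ⟶ tensorRight p.2 ⋙ B from φ.app p.2 x.2).app p.1 x.1
      naturality := by
        rintro ⟨X, Y⟩ ⟨X', Y'⟩ ⟨f, g⟩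
        ext ⟨a, y⟩
        have h1 := NatTrans.naturality_apply φ g y
        have h2 := NatTrans.naturality_apply
          (show A ⟶ tensorRight Y ⋙ B from φ.app Y y) f a
        change (show A ⟶ tensorRight Y' ⋙ B from φ.app Y' (G.map g y)).app X' (A.map f a) =
          B.map (f ⊗ₘ g) ((show A ⟶ tensorRight Y ⋙ B from φ.app Y y).app X a)
        rw [h1]
        change B.map (X' ◁ g) ((show A ⟶ tensorRight Y ⋙ B from φ.app Y y).app X'
          (A.map f a)) = _
        rw [h2]
        change B.map (X' ◁ g) (B.map (f ▷ Y) _) = _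
        rw [← Functor.map_comp_apply, MonoidalCategory.tensorHom_def] }
  invFun ψ :=
    { app := fun Y => TypeCat.ofHom fun (y : G.obj Y) =>
        (show A ⟶ tensorRight Y ⋙ B from
          { app := fun X => TypeCat.ofHom fun (a : A.obj X) =>
              ψ.app (X, Y) (show A.obj X × G.obj Y from (a, y))
            naturality := by
              intro X X' f
              ext a
              have h := NatTrans.naturality_apply ψ (X := (X, Y)) (Y := (X', Y)) (f, 𝟙 Y)
                (show A.obj X × G.obj Y from (a, y))
              change ψ.app (X', Y) (show A.obj X' × G.obj Y from (A.map f a, G.map (𝟙 Y) y)) =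
                B.map (f ⊗ₘ 𝟙 Y) _ at h
              rw [G.map_id, MonoidalCategory.tensorHom_id] at h
              exact h })
      naturality := by
        intro Y Y' g
        ext y
        apply NatTrans.ext
        funext X
        ext a
        have h := NatTrans.naturality_apply ψ (X := (X, Y)) (Y := (X, Y')) (𝟙 X, g)
          (show A.obj X × G.obj Y from (a, y))
        change ψ.app (X, Y') (show A.obj X × G.obj Y' from (A.map (𝟙 X) a, G.map g y)) =
          B.map (𝟙 X ⊗ₘ g) _ at h
        rw [A.map_id, MonoidalCategory.id_tensorHom] at h
        exact h }
  left_inv _ := rfl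
  right_inv _ := rfl

/-- The explicit internal hom represents maps out of the Day convolution. -/
noncomputable def ihomRep (A B : C ⥤ Type u) :
    ((dayLeft A).op ⋙ yoneda.obj B).RepresentableBy (ihomFun A B) where
  homEquiv {G} := (ihomCurry A B G).trans
    (((tensor C).lanAdjunction (Type u)).homEquiv ((extProdLeft A).obj G) B).symm
  homEquiv_comp {G G'} f g :=
    ((tensor C).lanAdjunction (Type u)).homEquiv_naturality_left_symm
      ((extProdLeft A).map f) (ihomCurry A B G' g)

/-- Shifting the explicit internal hom. -/
def ihomShift (A B : C ⥤ Type u) (U : C) :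
    tensorRight U ⋙ ihomFun A B ≅ ihomFun A (tensorRight U ⋙ B) :=
  Functor.isoWhiskerRight
    (show tensorRight U ⋙ tensoringRight C ≅
        tensoringRight C ⋙ (Functor.whiskeringRight C C C).obj (tensorRight U) from
      NatIso.ofComponents
        (fun V => NatIso.ofComponents (fun X => (α_ X V U).symm)
          (by intros; simp))
        (by intros; ext; simp))
    ((Functor.whiskeringRight C C (Type u)).obj B ⋙ coyoneda.obj (Opposite.op A))

/-- The Day convolution internal hom commutes with shifting: writing `sh_U^*` for
precomposition with `- ⊗ U`, one has `sh_U^* 𝓕(A, B) ≅ 𝓕(A, sh_U^* B)`. -/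
theorem internalHom_shift [SymmetricCategory C] (A B : C ⥤ Type u) (U : C)
    (R : (C ⥤ Type u) ⥤ (C ⥤ Type u)) (adj : dayLeft A ⊣ R) :
    Nonempty (tensorRight U ⋙ R.obj B ≅ R.obj (tensorRight U ⋙ B)) := by
  exact ⟨Functor.isoWhiskerLeft (tensorRight U)
      ((adj.representableBy B).uniqueUpToIso (ihomRep A B)) ≪≫ ihomShift A B U ≪≫
    ((adj.representableBy (tensorRight U ⋙ B)).uniqueUpToIso
      (ihomRep A (tensorRight U ⋙ B))).symm⟩
end

section
/- Let C be a small symmetric monoidal category and U an object of C; write sh_U^* for precomposition with the functor V ↦ V ⊗ U and (sh_U)_! for its left adjoint, given by left Kan extension along V ↦ V ⊗ U. Then for all A, B : C ⥤ Type there is a natural isomorphism ((sh_U)_! A) ⊛ B ≅ (sh_U)_! (A ⊛ B). -/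
open CategoryTheory MonoidalCategory Limits

universe u

variable {C : Type u} [SmallCategory C] [MonoidalCategory C]

open scoped CategoryTheory.MonoidalCategory.ExternalProduct

/-- Comparison of the two descriptions of the external product. -/
def extIso (F G : C ⥤ Type u) : F.prod G ⋙ tensor (Type u) ≅ F ⊠ G :=
  NatIso.ofComponents (fun _ => Iso.refl _) (by
    rintro ⟨X, Y⟩ ⟨X', Y'⟩ ⟨f, g⟩
    simp [MonoidalCategory.tensorHom_def])

/-- Swapping the last two tensor factors. -/
def shiftIso [SymmetricCategory C] (U : C) :
    (tensorRight U).prod (𝟭 C) ⋙ tensor C ≅ tensor C ⋙ tensorRight U :=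
  NatIso.ofComponents
    (fun p => α_ p.1 U p.2 ≪≫ whiskerLeftIso p.1 (β_ U p.2) ≪≫ (α_ p.1 p.2 U).symm) (by
    rintro ⟨X, Y⟩ ⟨X', Y'⟩ ⟨f, g⟩
    simp [MonoidalCategory.tensorHom_def]
    rw [← MonoidalCategory.whiskerLeft_comp_assoc X', BraidedCategory.braiding_naturality_right,
      MonoidalCategory.whiskerLeft_comp_assoc, associator_naturality_left_assoc,
      ← whisker_exchange_assoc, associator_naturality_left_assoc, Iso.inv_hom_id_assoc])

/-- The unit of `A ⊠ B` into `day A B`. -/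
noncomputable def dayUnit (A B : C ⥤ Type u) : A ⊠ B ⟶ tensor C ⋙ day A B :=
  (extIso A B).inv ≫ (tensor C).leftKanExtensionUnit _

theorem dayUnit_isLan (A B : C ⥤ Type u) : (day A B).IsLeftKanExtension (dayUnit A B) := by
  refine (Functor.isLeftKanExtension_iff_of_iso₂
    ((tensor C).leftKanExtensionUnit (A.prod B ⋙ tensor (Type u))) (dayUnit A B)
    (extIso A B) (Iso.refl _) ?_).1 inferInstance
  simp [dayUnit, day]

theorem ext_isLan (U : C) (A B : C ⥤ Type u) :
    (((tensorRight U).leftKanExtension A) ⊠ B).IsLeftKanExtension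
      (ExternalProduct.extensionUnitLeft _ ((tensorRight U).leftKanExtensionUnit A) B) := by
  have : ∀ (d e : C), PreservesColimitsOfShape (CostructuredArrow (tensorRight U) d)
      (tensorRight (B.obj e)) := fun d e =>
    preservesColimitsOfShape_of_natIso (BraidedCategory.tensorLeftIsoTensorRight (B.obj e))
  exact (ExternalProduct.isPointwiseLeftKanExtensionExtensionUnitLeft _ _ B
    (Functor.isPointwiseLeftKanExtensionOfIsLeftKanExtension _
      ((tensorRight U).leftKanExtensionUnit A))).isLeftKanExtension

/-- Day convolution commutes with the left adjoint `(sh_U)_!` of shifting: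
`((sh_U)_! A) ⊛ B ≅ (sh_U)_! (A ⊛ B)`, where `(sh_U)_!` is the left Kan extension along
`- ⊗ U`. -/
theorem shiftShriek_day [SymmetricCategory C] (U : C) (A B : C ⥤ Type u) :
    Nonempty (day ((tensorRight U).leftKanExtension A) B ≅
      (tensorRight U).leftKanExtension (day A B)) := by
  have := ext_isLan U A B
  have := dayUnit_isLan A B
  have h1 := (Functor.isLeftKanExtension_iff_postcompose
    (ExternalProduct.extensionUnitLeft _ ((tensorRight U).leftKanExtensionUnit A) B)
    (tensor C ⋙ tensorRight U) (shiftIso U)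
    (dayUnit ((tensorRight U).leftKanExtension A) B) _ rfl).1 (dayUnit_isLan _ _)
  have h2 := (Functor.isLeftKanExtension_iff_postcompose (dayUnit A B)
    (tensor C ⋙ tensorRight U) (Iso.refl _)
    ((tensorRight U).leftKanExtensionUnit (day A B)) _ rfl).1 inferInstance
  exact ⟨@Functor.leftKanExtensionUnique _ _ _ _ _ _ _ _ _ _ h1 _ _ h2⟩
end

section
/- Let E be a closed symmetric monoidal category and D a reflective full subcategory of E with reflector L, such that for every object A of E and every object P of D the internal hom [A, P] lies in D. Then for every morphism f of E such that L(f) is an isomorphism and every object C of E, L(f ⊗ id_C) is an isomorphism; consequently the tensor product of any two L-local equivalences is an L-local equivalence. -/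
open CategoryTheory MonoidalCategory

universe v₁ v₂ u₁ u₂

/-- For a reflective full subcategory `D` of a closed symmetric monoidal category `E` such
that every internal hom `[A, P]` with `P` in `D` again lies in `D`, tensoring an `L`-local
equivalence with an identity yields an `L`-local equivalence; consequently the tensor
product of two `L`-local equivalences is an `L`-local equivalence. -/
theorem monoidal_localization_compatibility
    {E : Type u₁} {D : Type u₂} [Category.{v₁} E] [Category.{v₂} D]
    [MonoidalCategory E] [SymmetricCategory E] [MonoidalClosed E]
    (ι : D ⥤ E) [ι.Full] [ι.Faithful] (L : E ⥤ D) (adj : L ⊣ ι)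
    (hhom : ∀ (A : E) (P : D), ι.essImage ((ihom A).obj (ι.obj P))) :
    (∀ {X Y : E} (f : X ⟶ Y), IsIso (L.map f) →
      ∀ Z : E, IsIso (L.map (f ⊗ₘ 𝟙 Z))) ∧
    (∀ {X Y X' Y' : E} (f : X ⟶ Y) (g : X' ⟶ Y'),
      IsIso (L.map f) → IsIso (L.map g) → IsIso (L.map (f ⊗ₘ g))) := by
  have left : ∀ {X Y : E} (f : X ⟶ Y), IsIso (L.map f) → ∀ Z : E, IsIso (L.map (Z ◁ f)) := by
    intro X Y f hf Z
    rw [← ObjectProperty.isLocal_iff_isIso_map adj] at hf ⊢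
    rintro _ ⟨P, rfl⟩
    obtain ⟨Q, ⟨e⟩⟩ := hhom Z P
    have hb := hf (ι.obj Q) ⟨Q, rfl⟩
    constructor
    · intro a b hab
      apply MonoidalClosed.curry_injective
      rw [← cancel_mono e.inv]
      apply hb.1
      have h2 := congrArg MonoidalClosed.curry hab
      simp only [MonoidalClosed.curry_natural_left] at h2
      simp only [← Category.assoc, h2]
    · intro g
      obtain ⟨h, hh⟩ := hb.2 (MonoidalClosed.curry g ≫ e.inv)
      refine ⟨MonoidalClosed.uncurry (h ≫ e.hom), ?_⟩
      have hh' : f ≫ h = MonoidalClosed.curry g ≫ e.inv := hh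
      change Z ◁ f ≫ MonoidalClosed.uncurry (h ≫ e.hom) = g
      rw [← MonoidalClosed.uncurry_natural_left, ← Category.assoc, hh']
      simp
  have right : ∀ {X Y : E} (f : X ⟶ Y), IsIso (L.map f) → ∀ Z : E, IsIso (L.map (f ▷ Z)) := by
    intro X Y f hf Z
    have := left f hf Z
    have h : f ▷ Z = (β_ X Z).hom ≫ Z ◁ f ≫ (β_ Y Z).inv := by simp
    rw [h, L.map_comp, L.map_comp]
    infer_instance
  refine ⟨fun f hf Z => ?_, fun {X Y X' Y'} f g hf hg => ?_⟩
  · rw [tensorHom_id]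
    exact right f hf Z
  · have := right f hf X'
    have := left g hg Y
    rw [MonoidalCategory.tensorHom_def, L.map_comp]
    infer_instance
end

section
/- Let E be a symmetric monoidal category and D a reflective full subcategory of E with reflector L, such that for every L-local equivalence f and every object C of E, f ⊗ id_C is an L-local equivalence. Then for every commutative monoid object A in E there is a commutative monoid object structure on L(A) such that the adjunction unit A → L(A) is a morphism of commutative monoid objects. -/
open CategoryTheory MonoidalCategory

universe v₁ v₂ u₁ u₂

theorem refl_hom_ext
    {E : Type u₁} {D : Type u₂} [Category.{v₁} E] [Category.{v₂} D]
    {ι : D ⥤ E} {L : E ⥤ D} (adj : L ⊣ ι) {X Y : E} (f : X ⟶ Y) (hf : IsIso (L.map f))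
    {d : D} (g h : Y ⟶ ι.obj d) (e : f ≫ g = f ≫ h) : g = h := by
  apply (adj.homEquiv _ _).symm.injective
  rw [← cancel_epi (L.map f), ← adj.homEquiv_naturality_left_symm,
    ← adj.homEquiv_naturality_left_symm, e]

theorem refl_hom_lift
    {E : Type u₁} {D : Type u₂} [Category.{v₁} E] [Category.{v₂} D]
    {ι : D ⥤ E} {L : E ⥤ D} (adj : L ⊣ ι) {X Y : E} (f : X ⟶ Y) (hf : IsIso (L.map f))
    {d : D} (g : X ⟶ ι.obj d) : ∃ h : Y ⟶ ι.obj d, f ≫ h = g := by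
  refine ⟨adj.homEquiv _ _ (inv (L.map f) ≫ (adj.homEquiv _ _).symm g), ?_⟩
  rw [← adj.homEquiv_naturality_left]
  simp

/-- For a reflective full subcategory `D` of a symmetric monoidal category `E` whose
reflector `L` is compatible with the tensor product (tensoring an `L`-local equivalence
with an identity is an `L`-local equivalence), the reflection of a commutative monoid
object carries a commutative monoid structure such that the adjunction unit is a morphism
of commutative monoid objects. -/
theorem reflection_of_commMon
    {E : Type u₁} {D : Type u₂} [Category.{v₁} E] [Category.{v₂} D]
    [MonoidalCategory E] [SymmetricCategory E]
    (ι : D ⥤ E) [ι.Full] [ι.Faithful] (L : E ⥤ D) (adj : L ⊣ ι)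
    (hcompat : ∀ {X Y : E} (f : X ⟶ Y), IsIso (L.map f) →
      ∀ Z : E, IsIso (L.map (f ⊗ₘ 𝟙 Z))) :
    ∀ M : CommMon E, ∃ (N : CommMon E) (hN : N.X = ι.obj (L.obj M.X))
      (η : M ⟶ N), η.hom.hom = adj.unit.app M.X ≫ eqToHom hN.symm := by
  intro M
  have hr : ∀ {X Y : E} (f : X ⟶ Y), IsIso (L.map f) → ∀ Z : E, IsIso (L.map (f ▷ Z)) := by
    intro X Y f hf Z
    simpa using hcompat f hf Z
  have hl : ∀ {X Y : E} (f : X ⟶ Y), IsIso (L.map f) → ∀ Z : E, IsIso (L.map (Z ◁ f)) := by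
    intro X Y f hf Z
    have h1 := hr f hf Z
    have : Z ◁ f = (β_ Z X).hom ≫ f ▷ Z ≫ (β_ Z Y).inv := by
      rw [← BraidedCategory.braiding_naturality_right_assoc]
      simp
    rw [this, L.map_comp, L.map_comp]
    infer_instance
  have hc : ∀ {X Y Z : E} (f : X ⟶ Y) (g : Y ⟶ Z), IsIso (L.map f) → IsIso (L.map g) →
      IsIso (L.map (f ≫ g)) := by
    intro X Y Z f g _ _
    rw [L.map_comp]
    infer_instance
  suffices key : ∀ (d : D) (u : M.X ⟶ ι.obj d), IsIso (L.map u) →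
      ∃ (N : CommMon E) (hN : N.X = ι.obj d) (η : M ⟶ N), η.hom.hom = u ≫ eqToHom hN.symm from
    key _ (adj.unit.app M.X) inferInstance
  intro d u hui
  have huu : IsIso (L.map (u ▷ M.X ≫ ι.obj d ◁ u)) := hc _ _ (hr _ hui _) (hl _ hui _)
  obtain ⟨m, hm⟩ := refl_hom_lift adj _ huu (MonObj.mul ≫ u)
  simp only [Category.assoc] at hm
  have hm' : M.X ◁ u ≫ u ▷ ι.obj d ≫ m = MonObj.mul ≫ u := by
    rw [← hm, whisker_exchange_assoc]
  let inst : MonObj (ι.obj d) :=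
    { one := MonObj.one ≫ u
      mul := m
      one_mul := by
        apply refl_hom_ext adj _ (hl _ hui _)
        rw [comp_whiskerRight, Category.assoc, whisker_exchange_assoc, hm']
        simp
      mul_one := by
        apply refl_hom_ext adj _ (hr _ hui _)
        rw [whiskerLeft_comp, Category.assoc, ← whisker_exchange_assoc, hm]
        simp
      mul_assoc := by
        apply refl_hom_ext adj (((u ▷ M.X ≫ ι.obj d ◁ u) ▷ M.X) ≫ (ι.obj d ⊗ ι.obj d) ◁ u)
          (hc _ _ (hr _ huu _) (hl _ hui _))
        have e1 : (((u ▷ M.X ≫ ι.obj d ◁ u) ▷ M.X) ≫ (ι.obj d ⊗ ι.obj d) ◁ u) ≫ m ▷ ι.obj d ≫ m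
            = (MonObj.mul ▷ M.X ≫ MonObj.mul) ≫ u := by
          rw [Category.assoc, whisker_exchange_assoc, ← comp_whiskerRight_assoc, Category.assoc,
            hm, comp_whiskerRight_assoc, hm, Category.assoc]
        have e2 : (((u ▷ M.X ≫ ι.obj d ◁ u) ▷ M.X) ≫ (ι.obj d ⊗ ι.obj d) ◁ u) ≫
              (α_ _ _ _).hom
            = (α_ _ _ _).hom ≫ u ▷ _ ≫ ι.obj d ◁ (u ▷ M.X ≫ ι.obj d ◁ u) := by
          simp
        rw [e1, ← Category.assoc _ (α_ _ _ _).hom, e2]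
        simp only [Category.assoc]
        rw [← whiskerLeft_comp_assoc (ι.obj d) (u ▷ M.X ≫ ι.obj d ◁ u) m, Category.assoc, hm,
          ← whisker_exchange_assoc, whiskerLeft_comp_assoc, hm']
        simp }
  have inst2 : IsCommMonObj (ι.obj d) :=
    { mul_comm := by
        change (β_ _ _).hom ≫ m = m
        apply refl_hom_ext adj _ huu
        simp only [Category.assoc]
        rw [BraidedCategory.braiding_naturality_right_assoc,
          BraidedCategory.braiding_naturality_left_assoc, hm', hm]
        simp }
  have inst3 : IsMonHom u :=
    { one_hom := rfl
      mul_hom := by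
        change _ = (u ⊗ₘ u) ≫ m
        rw [MonoidalCategory.tensorHom_def, Category.assoc, hm] }
  exact ⟨⟨ι.obj d⟩, rfl, CommMon.homMk (@Mon.Hom.mk _ _ _ M.toMon ⟨ι.obj d⟩ u inst3), (Category.comp_id u).symm⟩
end
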